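/- arXiv:0807.0921 — 5 statements merged into one kernel-verified Lean document; each statement's English description precedes it below -/
import Mathlib

section
/- Let A ∈ ℝ₊^{n×n} have per(A) > 0. Then for any two maximal permutations σ and τ of A, the column Kleene stars coincide, (A^{cσ})* = (A^{cτ})*, and the row Kleene stars coincide, (A^{rσ})* = (A^{rτ})*. -/
open scoped NNReal Classical

namespace MaxAlg

noncomputable section

variable {n m k N : ℕ}

/-- Support of a vector in `ℝ₊ⁿ`. -/
def supp (y : Fin n → ℝ≥0) : Set (Fin n) := { i | y i ≠ 0 }

/-- The multiorder relation `u ≤_j v`. -/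
def leOrd (j : Fin n) (u v : Fin n → ℝ≥0) : Prop :=
  u j ≠ 0 ∧ v j ≠ 0 ∧ ∀ i, u i / u j ≤ v i / v j

/-- Max span of a set of vectors: all finite max combinations. -/
def maxSpan (S : Set (Fin n → ℝ≥0)) : Set (Fin n → ℝ≥0) :=
  { y | ∃ (F : Finset (Fin n → ℝ≥0)) (lam : (Fin n → ℝ≥0) → ℝ≥0),
      ↑F ⊆ S ∧ y = F.sup fun v => lam v • v }

/-- A max cone: closed under componentwise max and nonnegative scaling. -/
def IsMaxCone (V : Set (Fin n → ℝ≥0)) : Prop :=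
  (∀ u ∈ V, ∀ w ∈ V, u ⊔ w ∈ V) ∧ ∀ (c : ℝ≥0), ∀ u ∈ V, c • u ∈ V

/-- Extremal vector of a max cone. -/
def IsExtremal (V : Set (Fin n → ℝ≥0)) (v : Fin n → ℝ≥0) : Prop :=
  v ∈ V ∧ v ≠ 0 ∧ ∀ u ∈ V, ∀ w ∈ V, v = u ⊔ w → v = u ∨ v = w

/-- Minimality w.r.t. `≤_j` in a set `W`. -/
def MinimalOrd (j : Fin n) (W : Set (Fin n → ℝ≥0)) (v : Fin n → ℝ≥0) : Prop :=
  v ∈ W ∧ v j ≠ 0 ∧ ∀ u ∈ W, leOrd j u v → leOrd j v u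

/-- Max-algebraic matrix-vector product. -/
def mulVec (A : Matrix (Fin n) (Fin m) ℝ≥0) (x : Fin m → ℝ≥0) : Fin n → ℝ≥0 :=
  fun i => Finset.univ.sup fun j => A i j * x j

/-- Max-algebraic column span of a matrix. -/
def matSpan (A : Matrix (Fin n) (Fin m) ℝ≥0) : Set (Fin n → ℝ≥0) :=
  { y | ∃ x : Fin m → ℝ≥0, y = mulVec A x }

/-- Max-algebraic matrix product. -/
def mProd (A B : Matrix (Fin n) (Fin n) ℝ≥0) : Matrix (Fin n) (Fin n) ℝ≥0 :=
  fun i j => Finset.univ.sup fun t => A i t * B t j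

/-- Max-algebraic identity matrix. -/
def mId (n : ℕ) : Matrix (Fin n) (Fin n) ℝ≥0 :=
  fun i j => if i = j then 1 else 0

/-- Max-algebraic matrix power. -/
def mPow (A : Matrix (Fin n) (Fin n) ℝ≥0) : ℕ → Matrix (Fin n) (Fin n) ℝ≥0
  | 0 => mId n
  | t + 1 => mProd (mPow A t) A

/-- Maximum cycle geometric mean `λ(A)`. -/
def maxCycleMean (A : Matrix (Fin n) (Fin n) ℝ≥0) : ℝ≥0 :=
  sSup { w | ∃ (p : ℕ) (hp : 0 < p) (c : Fin p → Fin n),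
    w = (∏ t : Fin p, A (c t) (c ⟨((t : ℕ) + 1) % p, Nat.mod_lt _ hp⟩)) ^ ((1 : ℝ) / (p : ℝ)) }

/-- Kleene star `A* = I ⊕ A ⊕ ⋯ ⊕ A^{n-1}`. -/
def kleene (A : Matrix (Fin n) (Fin n) ℝ≥0) : Matrix (Fin n) (Fin n) ℝ≥0 :=
  fun i j => (Finset.range n).sup fun t => mPow A t i j

/-- Eigencone `V(A)`. -/
def eigCone (A : Matrix (Fin n) (Fin n) ℝ≥0) : Set (Fin n → ℝ≥0) :=
  { x | mulVec A x = x }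

/-- Subeigencone `V*(A)`. -/
def subEigCone (A : Matrix (Fin n) (Fin n) ℝ≥0) : Set (Fin n → ℝ≥0) :=
  { x | mulVec A x ≤ x }

/-- Kleene star predicate: multiplicatively idempotent with unit diagonal. -/
def IsKleeneStar (Q : Matrix (Fin n) (Fin n) ℝ≥0) : Prop :=
  mProd Q Q = Q ∧ ∀ i, Q i i = 1

/-- Projector onto a (closed) max cone: `P_V(y) = max{v ∈ V ∣ v ≤ y}`. -/
def proj (V : Set (Fin n → ℝ≥0)) (y : Fin n → ℝ≥0) : Fin n → ℝ≥0 :=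
  fun i => sSup ((fun v => v i) '' { v ∈ V | v ≤ y })

/-- Residuation `y / v = min_{i ∈ supp v} yᵢ/vᵢ`. -/
def resid (y v : Fin n → ℝ≥0) : ℝ≥0 :=
  sInf ((fun i => y i / v i) '' supp v)

/-- `(i,j)` is a critical edge: it lies on a cycle of geometric-mean weight 1. -/
def IsCriticalEdge (B : Matrix (Fin n) (Fin n) ℝ≥0) (i j : Fin n) : Prop :=
  ∃ (p : ℕ) (hp : 0 < p) (c : Fin p → Fin n) (t : Fin p),
    c t = i ∧ c ⟨((t : ℕ) + 1) % p, Nat.mod_lt _ hp⟩ = j ∧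
    (∏ s : Fin p, B (c s) (c ⟨((s : ℕ) + 1) % p, Nat.mod_lt _ hp⟩)) ^ ((1 : ℝ) / (p : ℝ)) = 1

/-- The matrix `A^S` associated with an `n`-tuple `S` of subsets of `[m]`. -/
def typeMat (A : Matrix (Fin n) (Fin m) ℝ≥0) (S : Fin n → Set (Fin m)) :
    Matrix (Fin n) (Fin n) ℝ≥0 :=
  fun i j =>
    if S j = ∅ then (if i = j then 1 else 0)
    else sSup ((fun t => A i t / A j t) '' S j)

/-- The closed region `cl(X_S)`. -/
def clRegion (A : Matrix (Fin n) (Fin m) ℝ≥0) (S : Fin n → Set (Fin m)) :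
    Set (Fin n → ℝ≥0) :=
  { y | ∀ t i : Fin n, ∀ j ∈ S i, A t j / A i j * y i ≤ y t }

/-- Row type of a positive vector w.r.t. a matrix. -/
def rowType (A : Matrix (Fin n) (Fin m) ℝ≥0) (y : Fin n → ℝ≥0) : Fin n → Set (Fin m) :=
  fun i => { j | ∀ t, A t j / y t ≤ A i j / y i }

/-- Max-algebraic permanent. -/
def maxPer (A : Matrix (Fin n) (Fin n) ℝ≥0) : ℝ≥0 :=
  Finset.univ.sup fun σ : Equiv.Perm (Fin n) => ∏ i, A i (σ i)

/-- Max-algebraic pseudoinverse `A^∇ = per(A)⁻¹ ⋅ A^adj`, where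
`(A^adj)_{ij} = per(A_{ji})`. -/
def pinv (A : Matrix (Fin (N + 1)) (Fin (N + 1)) ℝ≥0) :
    Matrix (Fin (N + 1)) (Fin (N + 1)) ℝ≥0 :=
  fun i j => (maxPer A)⁻¹ * maxPer (A.submatrix j.succAbove i.succAbove)

/-- Column normalization `A^{cσ}`. -/
def colNorm (A : Matrix (Fin n) (Fin n) ℝ≥0) (σ : Equiv.Perm (Fin n)) :
    Matrix (Fin n) (Fin n) ℝ≥0 :=
  fun i j => A i (σ j) / A j (σ j)

/-- Row normalization `A^{rσ}`. -/
def rowNorm (A : Matrix (Fin n) (Fin n) ℝ≥0) (σ : Equiv.Perm (Fin n)) :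
    Matrix (Fin n) (Fin n) ℝ≥0 :=
  fun i j => A (σ.symm i) j / A (σ.symm i) i

/-- The diagonal matrix `D^σ`. -/
def permDiag (A : Matrix (Fin n) (Fin n) ℝ≥0) (σ : Equiv.Perm (Fin n)) :
    Matrix (Fin n) (Fin n) ℝ≥0 :=
  fun i j => if j = σ i then A i j else 0

/-- The cyclic projector `P_k ∘ ⋯ ∘ P_1` onto the column spans of a family of matrices. -/
def cycProj {mdim : Fin k → ℕ} (A : (s : Fin k) → Matrix (Fin n) (Fin (mdim s)) ℝ≥0) :
    (Fin n → ℝ≥0) → Fin n → ℝ≥0 :=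
  fun y => (List.ofFn fun s => proj (matSpan (A s))).foldl (fun z f => f z) y

/-- The max-algebraic product `A^(1) ⊗ ⋯ ⊗ A^(k)` of a family of matrices. -/
def prodAll (A : Fin k → Matrix (Fin n) (Fin n) ℝ≥0) : Matrix (Fin n) (Fin n) ℝ≥0 :=
  (List.ofFn A).foldr mProd (mId n)

/-- The sequence of products `C^(m) = A^{(j(m))} ⊗ ⋯ ⊗ A^{(j(1))}`. -/
def prodSeq (A : Fin k → Matrix (Fin n) (Fin n) ℝ≥0) (j : ℕ → Fin k) :
    ℕ → Matrix (Fin n) (Fin n) ℝ≥0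
  | 0 => mId n
  | t + 1 => mProd (A (j (t + 1))) (prodSeq A j t)

/-- Hilbert projective distance, valued in the extended reals. -/
def rhoH (y1 y2 : Fin n → ℝ≥0) : EReal :=
  if supp y1 = supp y2 then
    ((Real.log ((sSup { t : ℝ≥0 | ∃ i ∈ supp y1, ∃ j ∈ supp y1,
        t = y1 i / y2 i * (y2 j / y1 j) } : ℝ≥0) : ℝ)) : EReal)
  else ⊤

/-- Max-plus (additive) matrix-vector product over `ℝ`. -/
def mpMulVec (A : Matrix (Fin n) (Fin m) ℝ) (x : Fin m → ℝ) : Fin n → ℝ :=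
  fun i => ⨆ j, (A i j + x j)

/-- Min-plus residuated product `Ā ⊗' y` over `ℝ`. -/
def mpDual (A : Matrix (Fin n) (Fin m) ℝ) (y : Fin n → ℝ) : Fin m → ℝ :=
  fun j => ⨅ i, (y i - A i j)

/-- Max-plus projector onto the column span of `A`: `P_A(y) = A ⊗ (Ā ⊗' y)`. -/
def mpProj (A : Matrix (Fin n) (Fin m) ℝ) (y : Fin n → ℝ) : Fin n → ℝ :=
  mpMulVec A (mpDual A y)

/-- Range seminorm `‖A‖ = max_{i,j,l}(a_{il} − a_{jl})`. -/
def mpNorm (A : Matrix (Fin n) (Fin m) ℝ) : ℝ :=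
  ⨆ i, ⨆ j, ⨆ l, (A i l - A j l)

/-- One sweep `P_k ∘ ⋯ ∘ P_1` of the max-plus alternating method. -/
def altStep {mdim : Fin k → ℕ} (A : (s : Fin k) → Matrix (Fin n) (Fin (mdim s)) ℝ) :
    (Fin n → ℝ) → Fin n → ℝ :=
  fun y => (List.ofFn fun s => mpProj (A s)).foldl (fun z f => f z) y

end

/-- The weight of the walk `c 0, c 1, …, c t` with respect to `B`. -/
noncomputable def walkWeight {n : ℕ} (B : Matrix (Fin n) (Fin n) ℝ≥0) (c : ℕ → Fin n) (t : ℕ) :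
    ℝ≥0 :=
  ∏ s ∈ Finset.range t, B (c s) (c (s + 1))

/-- Unit diagonal, and no permutation has weight exceeding `1`. -/
def IsStronglyDefinite {n : ℕ} (B : Matrix (Fin n) (Fin n) ℝ≥0) : Prop :=
  (∀ i, B i i = 1) ∧ ∀ ρ : Equiv.Perm (Fin n), ∏ i, B i (ρ i) ≤ 1

section Walks

variable {n : ℕ} {B C : Matrix (Fin n) (Fin n) ℝ≥0}

theorem walkWeight_le_mPow (c : ℕ → Fin n) (t : ℕ) :
    walkWeight B c t ≤ mPow B t (c 0) (c t) := by
  induction t with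
  | zero => simp [walkWeight, mPow, mId]
  | succ t ih =>
    rw [walkWeight, Finset.prod_range_succ]
    refine (mul_le_mul_left ih _).trans ?_
    exact Finset.le_sup (f := fun k => mPow B t (c 0) k * B k (c (t + 1))) (Finset.mem_univ (c t))

theorem mPow_le_of_walkWeight_le {t : ℕ} {i j : Fin n} {x : ℝ≥0}
    (h : ∀ c : ℕ → Fin n, c 0 = i → c t = j → walkWeight B c t ≤ x) : mPow B t i j ≤ x := by
  induction t generalizing j x with
  | zero =>
    by_cases hij : i = j
    · simpa [walkWeight, mPow, mId, hij] using h (fun _ => i) rfl hij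
    · simp [mPow, mId, hij]
  | succ t ih =>
    rw [mPow, mProd, Finset.sup_le_iff]
    intro k _
    rcases eq_or_ne (B k j) 0 with h0 | h0
    · simp [h0]
    rw [← le_div_iff₀ (pos_iff_ne_zero.2 h0)]
    refine ih fun c hc0 hct => ?_
    rw [le_div_iff₀ (pos_iff_ne_zero.2 h0)]
    convert h (Function.update c (t + 1) j) (by simpa [Function.update] using hc0) (by simp) using 1
    rw [walkWeight, walkWeight, Finset.prod_range_succ]
    congr 1
    · refine Finset.prod_congr rfl fun s hs => ?_
      rw [Finset.mem_range] at hs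
      rw [Function.update_of_ne (by omega), Function.update_of_ne (by omega)]
    · rw [Function.update_of_ne (by omega), Function.update_self, hct]

theorem walkWeight_add (c : ℕ → Fin n) (s t : ℕ) :
    walkWeight B c (s + t) = walkWeight B c s * walkWeight B (fun u => c (s + u)) t := by
  simp only [walkWeight, Finset.prod_range_add, add_assoc]

/-- Cutting a closed segment out of a walk. -/
theorem exists_walkWeight_splice (c : ℕ → Fin n) {x d : ℕ} (r : ℕ) (h : c x = c (x + d)) :
    ∃ c' : ℕ → Fin n, c' 0 = c 0 ∧ c' (x + r) = c (x + d + r) ∧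
      walkWeight B c (x + d + r) =
        walkWeight B c' (x + r) * walkWeight B (fun u => c (x + u)) d := by
  have hshift : ∀ u, (if x + u ≤ x then c (x + u) else c (x + u + d)) = c (x + d + u) := by
    intro u
    split_ifs with hu
    · obtain rfl : u = 0 := by omega
      simpa using h
    · congr 1
      omega
  refine ⟨fun s => if s ≤ x then c s else c (s + d), by simp, hshift r, ?_⟩
  rw [walkWeight_add, walkWeight_add, walkWeight_add]
  simp only [hshift]
  rw [mul_right_comm]
  congr 2
  refine Finset.prod_congr rfl fun s hs => ?_
  rw [Finset.mem_range] at hs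
  simp only [if_pos hs.le, if_pos (Nat.succ_le_of_lt hs)]

theorem walkWeight_le_one_of_injOn (hB : IsStronglyDefinite B) {c : ℕ → Fin n} {t : ℕ}
    (hc : c t = c 0) (hinj : Set.InjOn c (Set.Iio t)) : walkWeight B c t ≤ 1 := by
  cases t with
  | zero => simp [walkWeight]
  | succ m =>
    let f : Fin (m + 1) ↪ Fin n := ⟨fun s => c s, fun a b hab => Fin.ext (hinj a.2 b.2 hab)⟩
    refine le_of_eq_of_le ?_ (hB.2 ((finRotate (m + 1)).viaFintypeEmbedding f))
    rw [walkWeight, ← Fin.prod_univ_eq_prod_range (fun s => B (c s) (c (s + 1)))]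
    refine Fintype.prod_of_injective f f.injective _ _ (fun i hi => ?_) fun s => ?_
    · rw [Equiv.Perm.viaFintypeEmbedding_apply_notMem_range _ _ hi, hB.1]
    · rw [Equiv.Perm.viaFintypeEmbedding_apply_image]
      change B (c s) (c (s + 1)) = B (c s) (c (finRotate (m + 1) s))
      congr 1
      rcases eq_or_ne s (Fin.last m) with rfl | hs
      · simpa using hc
      · rw [coe_finRotate_of_ne_last hs]

theorem walkWeight_le_one (hB : IsStronglyDefinite B) (t : ℕ) (c : ℕ → Fin n)
    (hc : c t = c 0) : walkWeight B c t ≤ 1 := by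
  induction t using Nat.strong_induction_on generalizing c with
  | _ t ih =>
    by_cases hinj : Set.InjOn c (Set.Iio t)
    · exact walkWeight_le_one_of_injOn hB hc hinj
    obtain ⟨x, y, hxy, hy, hcxy⟩ : ∃ x y, x < y ∧ y < t ∧ c x = c y := by
      simp only [Set.InjOn, Set.mem_Iio, not_forall] at hinj
      obtain ⟨a, ha, b, hb, hab, hne⟩ := hinj
      rcases lt_or_gt_of_ne hne with h | h
      · exact ⟨a, b, h, hb, hab⟩
      · exact ⟨b, a, h, ha, hab.symm⟩
    obtain ⟨d, rfl⟩ := Nat.exists_eq_add_of_le hxy.le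
    obtain ⟨r, rfl⟩ := Nat.exists_eq_add_of_le hy.le
    obtain ⟨c', h0, hr, hw⟩ := exists_walkWeight_splice (B := B) c r hcxy
    rw [hw]
    exact mul_le_one' (ih _ (by omega) c' (by rw [hr, h0, hc]))
      (ih _ (by omega) _ (by simpa using hcxy.symm))

theorem walkWeight_le_kleene (hB : IsStronglyDefinite B) (t : ℕ) (c : ℕ → Fin n) :
    walkWeight B c t ≤ kleene B (c 0) (c t) := by
  induction t using Nat.strong_induction_on generalizing c with
  | _ t ih =>
    rcases lt_or_ge t n with htn | htn
    · exact (walkWeight_le_mPow c t).trans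
        (Finset.le_sup (f := fun t => mPow B t (c 0) (c _)) (Finset.mem_range.2 htn))
    obtain ⟨x, y, hxy, hy, hcxy⟩ : ∃ x y, x < y ∧ y ≤ t ∧ c x = c y := by
      obtain ⟨a, ha, b, hb, hne, hab⟩ := Finset.exists_ne_map_eq_of_card_lt_of_maps_to
        (s := Finset.range (t + 1)) (t := Finset.univ) (f := c) (by simp; omega) (by simp)
      rw [Finset.mem_range] at ha hb
      rcases lt_or_gt_of_ne hne with h | h
      · exact ⟨a, b, h, by omega, hab⟩
      · exact ⟨b, a, h, by omega, hab.symm⟩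
    obtain ⟨d, rfl⟩ := Nat.exists_eq_add_of_le hxy.le
    obtain ⟨r, rfl⟩ := Nat.exists_eq_add_of_le hy
    obtain ⟨c', h0, hr, hw⟩ := exists_walkWeight_splice (B := B) c r hcxy
    rw [hw, ← h0, ← hr]
    exact (mul_le_of_le_one_right' (walkWeight_le_one hB d _ (by simpa using hcxy.symm))).trans
      (ih _ (by omega) c')

theorem mPow_le_kleene (hB : IsStronglyDefinite B) (t : ℕ) (i j : Fin n) :
    mPow B t i j ≤ kleene B i j := by
  refine mPow_le_of_walkWeight_le fun c h0 ht => ?_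
  simpa [h0, ht] using walkWeight_le_kleene hB t c

theorem mPow_mul_mPow_le (s t : ℕ) (i k j : Fin n) :
    mPow B s i k * mPow B t k j ≤ mPow B (s + t) i j := by
  induction t generalizing j with
  | zero =>
    by_cases hkj : k = j <;> simp [mPow, mId, hkj]
  | succ t ih =>
    simp only [mPow, mProd, NNReal.mul_finset_sup]
    refine Finset.sup_mono_fun fun l _ => ?_
    rw [← mul_assoc]
    exact mul_le_mul_left (ih l) _

theorem kleene_mul_kleene_le (hB : IsStronglyDefinite B) (i k j : Fin n) :
    kleene B i k * kleene B k j ≤ kleene B i j := by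
  simp only [kleene, NNReal.mul_finset_sup, NNReal.finset_sup_mul]
  exact Finset.sup_le fun s _ => Finset.sup_le fun t _ =>
    (mPow_mul_mPow_le _ _ i k j).trans (mPow_le_kleene hB _ i j)

theorem kleene_le_kleene (hB : IsStronglyDefinite B) (h : ∀ i j, C i j ≤ kleene B i j)
    (i j : Fin n) : kleene C i j ≤ kleene B i j := by
  refine Finset.sup_le fun t ht => ?_
  clear ht
  induction t generalizing j with
  | zero => exact mPow_le_kleene hB 0 i j
  | succ t ih =>
    exact Finset.sup_le fun k _ =>
      (mul_le_mul' (ih k) (h k j)).trans (kleene_mul_kleene_le hB i k j)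

theorem mPow_transpose_le (t : ℕ) (i j : Fin n) : mPow B.transpose t j i ≤ mPow B t i j := by
  refine mPow_le_of_walkWeight_le fun c h0 ht => ?_
  convert walkWeight_le_mPow (B := B) (fun s => c (t - s)) t using 1
  · rw [walkWeight, walkWeight, ← Finset.prod_range_reflect]
    refine Finset.prod_congr rfl fun s hs => ?_
    rw [Finset.mem_range] at hs
    rw [Matrix.transpose_apply, show t - 1 - s + 1 = t - s by omega,
      show t - (s + 1) = t - 1 - s by omega]
  · simp [h0, ht]

theorem kleene_transpose : kleene B.transpose = (kleene B).transpose := by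
  funext i j
  exact Finset.sup_congr rfl fun t _ =>
    le_antisymm (mPow_transpose_le (B := B) t j i) (mPow_transpose_le (B := B.transpose) t i j)

/-- Every orbit of a permutation of weight `1` is a closed walk of weight `1`. -/
theorem walkWeight_orbit_eq_one (hB : IsStronglyDefinite B) {π : Equiv.Perm (Fin n)}
    (hπ : ∏ i, B i (π i) = 1) (j : Fin n) :
    walkWeight B (fun s => (π ^ s) j) (orderOf π) = 1 := by
  have hle : ∀ i, walkWeight B (fun s => (π ^ s) i) (orderOf π) ≤ 1 := fun i =>
    walkWeight_le_one hB _ _ (by simp [pow_orderOf_eq_one])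
  have hprod : ∏ i, walkWeight B (fun s => (π ^ s) i) (orderOf π) = 1 := by
    simp only [walkWeight]
    rw [Finset.prod_comm]
    refine Finset.prod_eq_one fun s _ => ?_
    simp only [pow_succ', Equiv.Perm.mul_apply]
    rw [Equiv.prod_comp (π ^ s) fun i => B i (π i), hπ]
  refine le_antisymm (hle j) ?_
  rw [← hprod, ← Finset.mul_prod_erase _ _ (Finset.mem_univ j)]
  exact mul_le_of_le_one_right' (Finset.prod_le_one' fun i _ => hle i)

theorem div_le_kleene (hB : IsStronglyDefinite B) {π : Equiv.Perm (Fin n)}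
    (hπ : ∏ i, B i (π i) = 1) (i j : Fin n) : B i (π j) / B j (π j) ≤ kleene B i j := by
  have horb := walkWeight_orbit_eq_one hB hπ j
  have hfix : (π ^ orderOf π) j = j := by simp [pow_orderOf_eq_one]
  obtain ⟨t, ht⟩ := Nat.exists_eq_succ_of_ne_zero (orderOf_pos π).ne'
  rw [ht] at horb hfix
  let c : ℕ → Fin n := fun s => if s = 0 then i else (π ^ s) j
  have hc : walkWeight B c (t + 1) ≤ kleene B i j := by
    have h := walkWeight_le_kleene hB (t + 1) c
    rwa [show c 0 = i from rfl, show c (t + 1) = j from hfix] at h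
  refine le_of_eq_of_le ?_ hc
  rw [walkWeight, Finset.prod_range_succ'] at horb
  rw [walkWeight, Finset.prod_range_succ', eq_comm]
  simp only [zero_add, pow_zero, pow_one, Equiv.Perm.one_apply] at horb
  simp only [c, Nat.add_eq_zero_iff, one_ne_zero, and_false, if_false, if_true, zero_add, pow_one]
  rw [eq_inv_of_mul_eq_one_left horb, mul_comm, div_eq_mul_inv]

end Walks

section ColumnNormalization

variable {n : ℕ} {A : Matrix (Fin n) (Fin n) ℝ≥0} {σ τ : Equiv.Perm (Fin n)}

theorem prod_colNorm (ρ : Equiv.Perm (Fin n)) :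
    ∏ i, colNorm A σ i (ρ i) = (∏ i, A i (σ (ρ i))) / ∏ i, A i (σ i) := by
  simp only [colNorm]
  rw [Finset.prod_div_distrib, Equiv.prod_comp ρ fun i => A i (σ i)]

theorem isStronglyDefinite_colNorm (hpos : 0 < ∏ i, A i (σ i))
    (hmax : ∀ ρ : Equiv.Perm (Fin n), ∏ i, A i (ρ i) ≤ ∏ i, A i (σ i)) :
    IsStronglyDefinite (colNorm A σ) := by
  refine ⟨fun i => div_self (Finset.prod_ne_zero_iff.1 hpos.ne' i (Finset.mem_univ i)), fun ρ => ?_⟩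
  rw [prod_colNorm]
  exact div_le_one_of_le₀ (hmax (ρ.trans σ)) zero_le

theorem kleene_colNorm_le (hpos : 0 < ∏ i, A i (σ i))
    (hmax : ∀ ρ : Equiv.Perm (Fin n), ∏ i, A i (ρ i) ≤ ∏ i, A i (σ i))
    (hτ : ∏ i, A i (τ i) = ∏ i, A i (σ i)) (i j : Fin n) :
    kleene (colNorm A τ) i j ≤ kleene (colNorm A σ) i j := by
  have hB := isStronglyDefinite_colNorm hpos hmax
  refine kleene_le_kleene hB (fun i j => ?_) i j
  have hπ : ∏ i, colNorm A σ i ((τ.trans σ.symm) i) = 1 := by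
    rw [prod_colNorm]
    simp only [Equiv.trans_apply, Equiv.apply_symm_apply, hτ]
    exact div_self hpos.ne'
  refine le_of_eq_of_le ?_ (div_le_kleene hB hπ i j)
  have hne : A (σ.symm (τ j)) (τ j) ≠ 0 := by
    simpa using Finset.prod_ne_zero_iff.1 hpos.ne' (σ.symm (τ j)) (Finset.mem_univ _)
  simp only [colNorm, Equiv.trans_apply, Equiv.apply_symm_apply]
  rw [div_div_div_cancel_right₀ hne]

theorem kleene_colNorm_eq (hpos : 0 < ∏ i, A i (σ i))
    (hmax : ∀ ρ : Equiv.Perm (Fin n), ∏ i, A i (ρ i) ≤ ∏ i, A i (σ i))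
    (hτ : ∏ i, A i (τ i) = ∏ i, A i (σ i)) :
    kleene (colNorm A σ) = kleene (colNorm A τ) := by
  funext i j
  exact le_antisymm (kleene_colNorm_le (hτ ▸ hpos) (hτ ▸ hmax) hτ.symm i j)
    (kleene_colNorm_le hpos hmax hτ i j)

theorem rowNorm_eq_transpose_colNorm (A : Matrix (Fin n) (Fin n) ℝ≥0) (σ : Equiv.Perm (Fin n)) :
    rowNorm A σ = (colNorm A.transpose σ.symm).transpose :=
  rfl

theorem prod_transpose_symm (A : Matrix (Fin n) (Fin n) ℝ≥0) (σ : Equiv.Perm (Fin n)) :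
    ∏ i, A.transpose i (σ.symm i) = ∏ i, A i (σ i) := by
  rw [← Equiv.prod_comp σ]
  simp

end ColumnNormalization

/-- column (resp. row) Kleene stars agree for all maximal permutations. -/
theorem stmt13 {n : ℕ} (A : Matrix (Fin n) (Fin n) ℝ≥0) (hper : 0 < maxPer A)
    (σ τ : Equiv.Perm (Fin n))
    (hσ : (∏ i, A i (σ i)) = maxPer A) (hτ : (∏ i, A i (τ i)) = maxPer A) :
    kleene (colNorm A σ) = kleene (colNorm A τ) ∧
    kleene (rowNorm A σ) = kleene (rowNorm A τ) := by
  have hmax : ∀ ρ : Equiv.Perm (Fin n), ∏ i, A i (ρ i) ≤ ∏ i, A i (σ i) := fun ρ =>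
    hσ ▸ Finset.le_sup (f := fun σ : Equiv.Perm (Fin n) => ∏ i, A i (σ i)) (Finset.mem_univ ρ)
  refine ⟨kleene_colNorm_eq (hσ ▸ hper) hmax (hτ.trans hσ.symm), ?_⟩
  rw [rowNorm_eq_transpose_colNorm, rowNorm_eq_transpose_colNorm, kleene_transpose,
    kleene_transpose]
  congr 1
  apply kleene_colNorm_eq <;> rw [prod_transpose_symm]
  · exact hσ ▸ hper
  · intro ρ
    rw [← Equiv.symm_symm ρ, prod_transpose_symm]
    exact hmax ρ.symm
  · rw [prod_transpose_symm, hτ, hσ]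

end MaxAlg
end

section
/- Let A^(1),…,A^(k) ∈ ℝ₊^{n×n} be Kleene stars such that span(A^(1)) ∩ … ∩ span(A^(k)) contains a vector all of whose coordinates are positive, and let P_i denote the projector onto span(A^(i)). Then for every y ∈ ℝ₊ⁿ with all coordinates positive, the sequence y^(m) = (P_k ∘ ⋯ ∘ P_1)^m(y) stabilizes after at most n−1 steps, i.e. y^(m) = y^(n−1) for all m ≥ n−1; equivalently, the max-algebraic product C = A^(1) ⊗ ⋯ ⊗ A^(k) satisfies Cⁿ = C^{n−1}. -/
open scoped NNReal Classical

namespace MaxAlg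

/-- Max-algebraic vector-matrix product. -/
noncomputable def vecMul {n : ℕ} (z : Fin n → ℝ≥0) (C : Matrix (Fin n) (Fin n) ℝ≥0) :
    Fin n → ℝ≥0 :=
  fun j => Finset.univ.sup fun h => z h * C h j

theorem le_vecMul {n : ℕ} (z : Fin n → ℝ≥0) (C : Matrix (Fin n) (Fin n) ℝ≥0) (h j : Fin n) :
    z h * C h j ≤ vecMul z C j :=
  Finset.le_sup (f := fun h => z h * C h j) (Finset.mem_univ h)

theorem exists_vecMul_eq {n : ℕ} (z : Fin n → ℝ≥0) (C : Matrix (Fin n) (Fin n) ℝ≥0)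
    (j : Fin n) : ∃ h, vecMul z C j = z h * C h j := by
  obtain ⟨h, -, hh⟩ := Finset.exists_mem_eq_sup Finset.univ ⟨j, Finset.mem_univ j⟩
    (fun h => z h * C h j)
  exact ⟨h, hh⟩

theorem le_mProd {n : ℕ} (A B : Matrix (Fin n) (Fin n) ℝ≥0) (i h j : Fin n) :
    A i h * B h j ≤ mProd A B i j :=
  le_vecMul (A i) B h j

theorem vecMul_mId {n : ℕ} (z : Fin n → ℝ≥0) : vecMul z (mId n) = z := by
  funext j
  apply le_antisymm
  · refine Finset.sup_le fun h _ => ?_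
    by_cases hj : h = j <;> simp [mId, hj]
  · simpa [mId] using le_vecMul z (mId n) j j

theorem vecMul_vecMul {n : ℕ} (z : Fin n → ℝ≥0) (A B : Matrix (Fin n) (Fin n) ℝ≥0) :
    vecMul (vecMul z A) B = vecMul z (mProd A B) := by
  funext j
  apply le_antisymm
  · refine Finset.sup_le fun h _ => ?_
    obtain ⟨g, hg⟩ := exists_vecMul_eq z A h
    rw [hg, mul_assoc]
    exact (mul_le_mul_right (le_mProd A B g h j) _).trans (le_vecMul z _ g j)
  · refine Finset.sup_le fun g _ => ?_
    obtain ⟨h, hh⟩ := exists_vecMul_eq (A g) B j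
    change z g * vecMul (A g) B j ≤ _
    rw [hh, ← mul_assoc]
    exact (mul_le_mul_left (le_vecMul z A g h) _).trans (le_vecMul _ B h j)

/-- A strict increase at step `m + 1` traces back along a path of strict increases whose
weighted values do not grow. -/
theorem exists_path_of_vecMul_lt {n : ℕ} {C : Matrix (Fin n) (Fin n) ℝ≥0} {x : Fin n → ℝ≥0}
    (hx : ∀ h j, C h j * x j ≤ x h) {v : ℕ → Fin n → ℝ≥0}
    (hv : ∀ t, v (t + 1) = vecMul (v t) C) (m : ℕ) (i : Fin n) (hi : v m i < v (m + 1) i) :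
    ∃ c : ℕ → Fin n, c (m + 1) = i ∧ ∀ t ≤ m, v t (c (t + 1)) < v (t + 1) (c (t + 1)) ∧
      v (t + 1) (c (t + 1)) * x (c (t + 1)) ≤ v t (c t) * x (c t) := by
  obtain ⟨h, hh⟩ := exists_vecMul_eq (v m) C i
  rw [← hv] at hh
  have hdesc : v (m + 1) i * x i ≤ v m h * x h := by
    rw [hh, mul_assoc]
    exact mul_le_mul_right (hx h i) _
  induction m generalizing i h with
  | zero =>
    refine ⟨fun t => if t = 0 then h else i, by simp, ?_⟩
    intro t ht
    obtain rfl : t = 0 := by omega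
    simpa using ⟨hi, hdesc⟩
  | succ m ih =>
    have hlt : v m h < v (m + 1) h := by
      by_contra hcon
      have h1 : v (m + 1) h * C h i ≤ v m h * C h i := mul_le_mul_left (not_lt.mp hcon) _
      have h2 : v m h * C h i ≤ v (m + 1) i := by
        rw [hv m]; exact le_vecMul _ _ _ _
      exact absurd hi (not_lt.mpr (hh ▸ h1.trans h2))
    obtain ⟨g, hg⟩ := exists_vecMul_eq (v m) C h
    rw [← hv] at hg
    have hdesc' : v (m + 1) h * x h ≤ v m g * x g := by
      rw [hg, mul_assoc]
      exact mul_le_mul_right (hx g h) _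
    obtain ⟨c, hc, hcs⟩ := ih h hlt g hg hdesc'
    refine ⟨fun t => if t = m + 2 then i else c t, by simp, ?_⟩
    intro t ht
    rcases Nat.lt_or_ge m t with hmt | hmt
    · obtain rfl : t = m + 1 := by omega
      simpa [hc] using ⟨hi, hdesc⟩
    · have h1 : t ≠ m + 1 := by omega
      have h2 : t ≠ m + 2 := by omega
      simpa [h1, h2] using hcs t hmt

/-- The orbit of a vector under a matrix dominating the identity and having a positive
subeigenvector is constant from step `n - 1` on. -/
theorem vecMul_orbit_stabilizes {n : ℕ} {C : Matrix (Fin n) (Fin n) ℝ≥0} {x : Fin n → ℝ≥0}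
    (hpos : ∀ i, 0 < x i) (hx : ∀ h j, C h j * x j ≤ x h) (hdiag : ∀ i, 1 ≤ C i i)
    {v : ℕ → Fin n → ℝ≥0} (hv : ∀ t, v (t + 1) = vecMul (v t) C) {t : ℕ} (ht : n - 1 ≤ t) :
    v t = v (n - 1) := by
  have hmono : Monotone v := by
    refine monotone_nat_of_le_succ fun t i => ?_
    rw [hv t]
    exact (le_mul_of_one_le_right' (hdiag i)).trans (le_vecMul _ _ i i)
  have hstep : v (n - 1 + 1) = v (n - 1) := by
    funext i
    by_contra hne
    have hi : v (n - 1) i < v (n - 1 + 1) i :=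
      lt_of_le_of_ne (hmono (Nat.le_succ _) i) (Ne.symm hne)
    obtain ⟨c, -, hc⟩ := exists_path_of_vecMul_lt hx hv (n - 1) i hi
    have hn : 0 < n := i.pos
    have hanti : ∀ s t, s ≤ t → t ≤ n → v t (c t) * x (c t) ≤ v s (c s) * x (c s) := by
      intro s t hst
      induction t, hst using Nat.le_induction with
      | base => intro _; exact le_rfl
      | succ t hst ih => exact fun htn => (hc t (by omega)).2.trans (ih (by omega))
    obtain ⟨a, b, hab, heq⟩ := Fintype.exists_ne_map_eq_of_card_lt
      (fun t : Fin (n + 1) => c t) (by simp)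
    have key : ∀ s t : ℕ, s < t → t ≤ n → c s = c t → False := by
      intro s t hst htn hct
      obtain ⟨t, rfl⟩ : ∃ u, t = u + 1 := ⟨t - 1, by omega⟩
      have h1 := hanti s (t + 1) hst.le htn
      rw [hct] at h1
      have h2 := le_of_mul_le_mul_right h1 (hpos _)
      exact absurd ((hc t (by omega)).1.trans_le h2)
        (not_lt.mpr (hmono (Nat.lt_succ_iff.mp hst) _))
    rcases lt_or_gt_of_ne (Fin.val_ne_of_ne hab) with h | h
    · exact key a b h (Nat.lt_succ_iff.mp b.2) heq
    · exact key b a h (Nat.lt_succ_iff.mp a.2) heq.symm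
  induction t, ht using Nat.le_induction with
  | base => rfl
  | succ t _ ih => rw [hv t, ih, ← hv, hstep]

theorem IsKleeneStar.mul_le {n : ℕ} {A : Matrix (Fin n) (Fin n) ℝ≥0} (hA : IsKleeneStar A)
    (i h j : Fin n) : A i h * A h j ≤ A i j := by
  simpa only [hA.1] using le_mProd A A i h j

theorem IsKleeneStar.mul_le_of_mem_matSpan {n : ℕ} {A : Matrix (Fin n) (Fin n) ℝ≥0}
    (hA : IsKleeneStar A) {v : Fin n → ℝ≥0} (hv : v ∈ matSpan A) (h j : Fin n) :
    A h j * v j ≤ v h := by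
  obtain ⟨w, rfl⟩ := hv
  obtain ⟨g, -, hg⟩ := Finset.exists_mem_eq_sup Finset.univ ⟨j, Finset.mem_univ j⟩
    (fun g => A j g * w g)
  have hg' : mulVec A w j = A j g * w g := hg
  rw [hg', ← mul_assoc]
  exact (mul_le_mul_left (hA.mul_le h j g) _).trans
    (Finset.le_sup (f := fun g => A h g * w g) (Finset.mem_univ g))

/-- On positive vectors, the projector onto the span of a Kleene star is conjugate to the
vector-matrix product through entrywise inversion. -/
theorem IsKleeneStar.proj_matSpan {n : ℕ} {A : Matrix (Fin n) (Fin n) ℝ≥0}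
    (hA : IsKleeneStar A) {y : Fin n → ℝ≥0} (hy : ∀ i, 0 < y i) :
    proj (matSpan A) y = (vecMul y⁻¹ A)⁻¹ := by
  have hle : ∀ j, (y j)⁻¹ ≤ vecMul y⁻¹ A j := fun j => by
    simpa [hA.2 j] using le_vecMul y⁻¹ A j j
  have hpos : ∀ j, 0 < vecMul y⁻¹ A j := fun j => (inv_pos.mpr (hy j)).trans_le (hle j)
  have hsub : ∀ i j, A i j * (vecMul y⁻¹ A j)⁻¹ ≤ (vecMul y⁻¹ A i)⁻¹ := by
    intro i j
    rw [← div_eq_mul_inv, div_le_iff₀ (hpos j), inv_mul_eq_div, le_div_iff₀ (hpos i)]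
    obtain ⟨h, hh⟩ := exists_vecMul_eq y⁻¹ A i
    rw [hh]
    calc A i j * (y⁻¹ h * A h i) = y⁻¹ h * (A h i * A i j) := by ring
      _ ≤ y⁻¹ h * A h j := mul_le_mul_right (hA.mul_le h i j) _
      _ ≤ _ := le_vecMul _ _ _ _
  funext j
  refine IsGreatest.csSup_eq ⟨⟨(vecMul y⁻¹ A)⁻¹, ⟨⟨(vecMul y⁻¹ A)⁻¹, ?_⟩, ?_⟩, rfl⟩, ?_⟩
  · funext i
    apply le_antisymm
    · have h := Finset.le_sup (f := fun j => A i j * (vecMul y⁻¹ A)⁻¹ j) (Finset.mem_univ i)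
      rwa [hA.2 i, one_mul] at h
    · exact Finset.sup_le fun j _ => hsub i j
  · exact fun i => inv_le_of_inv_le₀ (hy i) (hle i)
  · rintro _ ⟨v, ⟨hv, hvy⟩, rfl⟩
    obtain ⟨h, hh⟩ := exists_vecMul_eq y⁻¹ A j
    change v j ≤ (vecMul y⁻¹ A j)⁻¹
    rw [← one_div, le_div_iff₀ (hpos j), hh]
    calc v j * (y⁻¹ h * A h j) = y⁻¹ h * (A h j * v j) := by ring
      _ ≤ y⁻¹ h * y h :=
        mul_le_mul_right ((hA.mul_le_of_mem_matSpan hv h j).trans (hvy h)) _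
      _ = 1 := inv_mul_cancel₀ (hy h).ne'

theorem foldl_proj_eq {n : ℕ} (L : List (Matrix (Fin n) (Fin n) ℝ≥0))
    (hL : ∀ A ∈ L, IsKleeneStar A) {y : Fin n → ℝ≥0} (hy : ∀ i, 0 < y i) :
    (∀ i, 0 < (L.map fun A => proj (matSpan A)).foldl (fun z f => f z) y i) ∧
    ((L.map fun A => proj (matSpan A)).foldl (fun z f => f z) y)⁻¹ =
      vecMul y⁻¹ (L.foldr mProd (mId n)) := by
  induction L generalizing y with
  | nil => exact ⟨hy, (vecMul_mId _).symm⟩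
  | cons A L ih =>
    have hA := hL A List.mem_cons_self
    have hp := hA.proj_matSpan hy
    have hpos : ∀ i, 0 < proj (matSpan A) y i := fun i => by
      rw [hp]
      refine inv_pos.mpr ((inv_pos.mpr (hy i)).trans_le ?_)
      simpa [hA.2 i] using le_vecMul y⁻¹ A i i
    obtain ⟨h1, h2⟩ := ih (fun B hB => hL B (List.mem_cons_of_mem A hB)) hpos
    refine ⟨h1, ?_⟩
    simp only [List.map_cons, List.foldl_cons, List.foldr_cons]
    rw [h2, hp, inv_inv, vecMul_vecMul]

theorem foldr_mProd_diag {n : ℕ} (L : List (Matrix (Fin n) (Fin n) ℝ≥0))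
    (hL : ∀ A ∈ L, ∀ i, 1 ≤ A i i) (i : Fin n) : 1 ≤ L.foldr mProd (mId n) i i := by
  induction L with
  | nil => simp [mId]
  | cons A L ih =>
    have h1 := ih fun B hB => hL B (List.mem_cons_of_mem A hB)
    exact (one_le_mul (hL A List.mem_cons_self i) h1).trans (le_mProd A _ i i i)

theorem foldr_mProd_mul_le {n : ℕ} (L : List (Matrix (Fin n) (Fin n) ℝ≥0)) {x : Fin n → ℝ≥0}
    (hL : ∀ A ∈ L, ∀ h j, A h j * x j ≤ x h) (h j : Fin n) :
    L.foldr mProd (mId n) h j * x j ≤ x h := by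
  induction L generalizing h with
  | nil => by_cases hj : h = j <;> simp [mId, hj]
  | cons A L ih =>
    obtain ⟨g, hg⟩ := exists_vecMul_eq (A h) (L.foldr mProd (mId n)) j
    change vecMul (A h) (L.foldr mProd (mId n)) j * x j ≤ x h
    rw [hg, mul_assoc]
    exact (mul_le_mul_right (ih (fun B hB => hL B (List.mem_cons_of_mem A hB)) g) _).trans
      (hL A List.mem_cons_self h g)

/-- for Kleene stars whose cones share a positive vector, the alternating
method stabilizes in at most `n−1` steps; equivalently `Cⁿ = C^{n−1}` for
`C = A^(1) ⊗ ⋯ ⊗ A^(k)`. -/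
theorem stmt15 {n k : ℕ} (A : Fin k → Matrix (Fin n) (Fin n) ℝ≥0)
    (hA : ∀ s, IsKleeneStar (A s))
    (hpos : ∃ x : Fin n → ℝ≥0, (∀ s, x ∈ matSpan (A s)) ∧ ∀ i, 0 < x i) :
    (∀ y : Fin n → ℝ≥0, (∀ i, 0 < y i) →
      ∀ t : ℕ, n - 1 ≤ t →
        (cycProj (mdim := fun _ => n) A)^[t] y = (cycProj (mdim := fun _ => n) A)^[n - 1] y) ∧
    mPow (prodAll A) n = mPow (prodAll A) (n - 1) := by
  obtain ⟨x, hxA, hx⟩ := hpos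
  have hdiag : ∀ i, 1 ≤ prodAll A i i := foldr_mProd_diag _ fun B hB i => by
    obtain ⟨s, rfl⟩ := List.mem_ofFn.mp hB
    exact ((hA s).2 i).ge
  have hsub : ∀ h j, prodAll A h j * x j ≤ x h := foldr_mProd_mul_le _ fun B hB => by
    obtain ⟨s, rfl⟩ := List.mem_ofFn.mp hB
    exact (hA s).mul_le_of_mem_matSpan (hxA s)
  have hcyc : ∀ y : Fin n → ℝ≥0, (∀ i, 0 < y i) →
      (∀ i, 0 < cycProj (mdim := fun _ => n) A y i) ∧
      (cycProj (mdim := fun _ => n) A y)⁻¹ = vecMul y⁻¹ (prodAll A) := by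
    intro y hy
    have h := foldl_proj_eq (List.ofFn A) (fun B hB => by
      obtain ⟨s, rfl⟩ := List.mem_ofFn.mp hB
      exact hA s) hy
    rw [List.map_ofFn] at h
    exact h
  constructor
  · intro y hy t ht
    have hit : ∀ t i, 0 < (cycProj (mdim := fun _ => n) A)^[t] y i := by
      intro t
      induction t with
      | zero => exact hy
      | succ t ih => rw [Function.iterate_succ_apply']; exact (hcyc _ ih).1
    have hv : ∀ t, ((cycProj (mdim := fun _ => n) A)^[t + 1] y)⁻¹ =
        vecMul ((cycProj (mdim := fun _ => n) A)^[t] y)⁻¹ (prodAll A) := fun t => by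
      rw [Function.iterate_succ_apply']; exact (hcyc _ (hit t)).2
    exact inv_injective (vecMul_orbit_stabilizes hx hsub hdiag
      (v := fun t => ((cycProj (mdim := fun _ => n) A)^[t] y)⁻¹) hv ht)
  · funext i
    exact vecMul_orbit_stabilizes hx hsub hdiag (v := fun t => mPow (prodAll A) t i)
      (fun _ => rfl) (Nat.sub_le n 1)

end MaxAlg
end

section
/- Let A^(1),…,A^(k) ∈ ℝ₊^{n×n} have all diagonal entries equal to 1, and suppose that every max-algebraic product D of at most n matrices taken from {A^(1),…,A^(k)} (repetitions allowed, in any order) satisfies λ(D) ≤ 1. Fix any mapping j : {1,2,…} → [k] and set C^(m) = A^{(j(m))} ⊗ ⋯ ⊗ A^{(j(1))} for m ≥ 1. Then there exists m ≤ n^k − 1 such that C^(m) = C^(m+1). -/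
open scoped NNReal Classical

namespace MaxAlg

/-- The max-algebraic product of the matrices `A s` along a word in the indices. -/
noncomputable def wordProd {n k : ℕ} (A : Fin k → Matrix (Fin n) (Fin n) ℝ≥0) (L : List (Fin k)) :
    Matrix (Fin n) (Fin n) ℝ≥0 :=
  (L.map A).foldr mProd (mId n)

section WordProd

variable {n k : ℕ} (A : Fin k → Matrix (Fin n) (Fin n) ℝ≥0)

lemma wordProd_nil_apply (i l : Fin n) : wordProd A [] i l = if i = l then 1 else 0 := rfl

lemma wordProd_cons (s : Fin k) (L : List (Fin k)) :
    wordProd A (s :: L) = mProd (A s) (wordProd A L) := rfl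

lemma mul_le_mProd (B C : Matrix (Fin n) (Fin n) ℝ≥0) (i y l : Fin n) :
    B i y * C y l ≤ mProd B C i l :=
  Finset.le_sup (f := fun y => B i y * C y l) (Finset.mem_univ y)

lemma exists_mProd_eq (B C : Matrix (Fin n) (Fin n) ℝ≥0) (i l : Fin n) :
    ∃ y, mProd B C i l = B i y * C y l := by
  obtain ⟨y, -, hy⟩ := Finset.exists_mem_eq_sup Finset.univ ⟨i, Finset.mem_univ i⟩
    (fun y => B i y * C y l)
  exact ⟨y, hy⟩

lemma wordProd_mul_le_append (L M : List (Fin k)) (i x l : Fin n) :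
    wordProd A L i x * wordProd A M x l ≤ wordProd A (L ++ M) i l := by
  induction L generalizing i with
  | nil =>
    rw [wordProd_nil_apply]
    split_ifs with h
    · simp [h]
    · simp
  | cons s L ih =>
    obtain ⟨y, hy⟩ := exists_mProd_eq (A s) (wordProd A L) i x
    rw [wordProd_cons, hy, mul_assoc, List.cons_append, wordProd_cons]
    exact (mul_le_mul_right (ih y) _).trans (mul_le_mProd _ _ i y l)

variable {A} in
lemma wordProd_le_of_sublist (hdiag : ∀ s i, A s i i = 1) {u L : List (Fin k)} (h : u.Sublist L)
    (i l : Fin n) : wordProd A u i l ≤ wordProd A L i l := by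
  induction h generalizing i with
  | slnil => exact le_rfl
  | cons s _ ih =>
    refine (ih i).trans ?_
    simpa [hdiag, wordProd_cons] using mul_le_mProd (A s) (wordProd A _) i i l
  | cons_cons s _ ih =>
    rw [wordProd_cons, wordProd_cons]
    exact Finset.sup_mono_fun fun y _ => mul_le_mul_right (ih y) _

/-- An entry of a word product is realised by a walk, which can be cut at any two places. -/
lemma exists_walk (L : List (Fin k)) (i l : Fin n) :
    ∃ x : ℕ → Fin n, x 0 = i ∧ ∀ a b, a ≤ b → b ≤ L.length →
      wordProd A L i l ≤ wordProd A (L.take a) i (x a) *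
        wordProd A ((L.drop a).take (b - a)) (x a) (x b) * wordProd A (L.drop b) (x b) l := by
  induction L generalizing i with
  | nil =>
    refine ⟨fun _ => i, rfl, fun a b _ _ => ?_⟩
    simp [wordProd_nil_apply]
  | cons s L ih =>
    obtain ⟨y, hy⟩ := exists_mProd_eq (A s) (wordProd A L) i l
    obtain ⟨x, hx0, hx⟩ := ih y
    refine ⟨fun t => Nat.casesOn t i x, rfl, fun a b hab hb => ?_⟩
    rcases b with _ | b
    · obtain rfl : a = 0 := by omega
      simp [wordProd_nil_apply]
    have hb' : b ≤ L.length := by simpa using hb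
    rw [wordProd_cons, hy]
    rcases a with _ | a
    · have h := hx 0 b (Nat.zero_le _) hb'
      simp only [List.take_zero, wordProd_nil_apply, hx0, if_true, one_mul, List.drop_zero,
        Nat.sub_zero, List.take_succ_cons, List.drop_succ_cons] at h ⊢
      calc A s i y * wordProd A L y l
          ≤ A s i y * (wordProd A (L.take b) y (x b) * wordProd A (L.drop b) (x b) l) :=
            mul_le_mul_right h _
        _ = (A s i y * wordProd A (L.take b) y (x b)) * wordProd A (L.drop b) (x b) l :=
            (mul_assoc _ _ _).symm
        _ ≤ mProd (A s) (wordProd A (L.take b)) i (x b) * wordProd A (L.drop b) (x b) l :=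
            mul_le_mul_left (mul_le_mProd _ _ i y _) _
        _ = _ := by simp [wordProd_cons]
    · have h := hx a b (by omega) hb'
      simp only [List.take_succ_cons, List.drop_succ_cons, Nat.add_sub_add_right]
      refine (mul_le_mul_right h _).trans ?_
      rw [← mul_assoc, ← mul_assoc]
      exact mul_le_mul_left (mul_le_mul_left (mul_le_mProd _ _ i y _) _) _

end WordProd

lemma diag_le_maxCycleMean {n : ℕ} (B : Matrix (Fin n) (Fin n) ℝ≥0) (x : Fin n) :
    B x x ≤ maxCycleMean B := by
  refine le_csSup ?_ ⟨1, one_pos, fun _ => x, by simp⟩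
  refine ⟨Finset.univ.sup fun i => Finset.univ.sup fun l => B i l, ?_⟩
  rintro w ⟨p, hp, c, rfl⟩
  rw [one_div, NNReal.rpow_inv_le_iff (by exact_mod_cast hp), NNReal.rpow_natCast]
  calc _ ≤ ∏ _t : Fin p, (Finset.univ.sup fun i => Finset.univ.sup fun l => B i l) :=
        Finset.prod_le_prod' fun t _ =>
          (Finset.le_sup (f := fun l => B (c t) l) (Finset.mem_univ _)).trans
            (Finset.le_sup (f := fun i => Finset.univ.sup fun l => B i l) (Finset.mem_univ (c t)))
    _ = _ := by simp

/-- Cutting out cycles, an entry of a word product is dominated by that of a short subword. -/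
lemma exists_short_sublist {n k : ℕ} {A : Fin k → Matrix (Fin n) (Fin n) ℝ≥0}
    (hprod : ∀ L : List (Fin k), L.length ≤ n → maxCycleMean (wordProd A L) ≤ 1)
    (L : List (Fin k)) (i l : Fin n) :
    ∃ u : List (Fin k), u.Sublist L ∧ u.length < n ∧ wordProd A L i l ≤ wordProd A u i l := by
  by_cases hL : L.length < n
  · exact ⟨L, List.Sublist.refl L, hL, le_rfl⟩
  obtain ⟨x, -, hx⟩ := exists_walk A L i l
  obtain ⟨a, b, hab, hbn, hxab⟩ : ∃ a b : ℕ, a < b ∧ b ≤ n ∧ x a = x b := by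
    obtain ⟨a, b, hne, he⟩ := Fintype.exists_ne_map_eq_of_card_lt
      (fun t : Fin (n + 1) => x t) (by simp)
    rcases lt_or_gt_of_ne hne with h | h
    · exact ⟨a, b, h, by omega, he⟩
    · exact ⟨b, a, h, by omega, he.symm⟩
  have hsub : (L.take a ++ L.drop b).Sublist L := by
    conv_rhs => rw [← List.take_append_drop a L]
    exact (List.Sublist.refl _).append (List.drop_sublist_drop_left L hab.le)
  have hlen : (L.take a ++ L.drop b).length < L.length := by
    simp only [List.length_append, List.length_take, List.length_drop]
    omega
  obtain ⟨u, hu, hun, hle⟩ := exists_short_sublist hprod (L.take a ++ L.drop b) i l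
  refine ⟨u, hu.trans hsub, hun, le_trans ?_ hle⟩
  refine le_trans ?_ (wordProd_mul_le_append A (L.take a) (L.drop b) i (x b) l)
  refine (hx a b hab.le (by omega)).trans ?_
  have hcyc : wordProd A ((L.drop a).take (b - a)) (x b) (x b) ≤ 1 :=
    (diag_le_maxCycleMean _ _).trans (hprod _ (by
      simp only [List.length_take, List.length_drop]
      omega))
  rw [hxab]
  exact mul_le_mul_left (mul_le_of_le_one_right' hcyc) _
termination_by L.length

section Words

variable {k : ℕ} (j : ℕ → Fin k)

/-- The word `j t, …, j 1`. -/
def revWord : ℕ → List (Fin k)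
  | 0 => []
  | t + 1 => j (t + 1) :: revWord t

/-- A lower bound for the length of the subwords of `revWord j t` which cease to be
subwords when `s` is appended to them. -/
def extBound : ℕ → Fin k → ℕ
  | 0, _ => 0
  | t + 1, s =>
    if s = j (t + 1) then extBound t s + 1 else min (extBound t s) (extBound t (j (t + 1)) + 1)

lemma cons_sublist_revWord {t : ℕ} {s : Fin k} {w : List (Fin k)}
    (hw : w.Sublist (revWord j t)) (hlen : w.length < extBound j t s) :
    (s :: w).Sublist (revWord j t) := by
  induction t generalizing s w with
  | zero => simp [extBound] at hlen
  | succ t ih =>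
    rw [revWord, List.sublist_cons_iff] at hw
    rw [extBound] at hlen
    split_ifs at hlen with hs
    · subst hs
      rcases hw with hw | ⟨w, rfl, hw⟩
      · exact hw.cons_cons _
      · exact (ih hw (by simpa using hlen)).cons_cons _
    · obtain ⟨h1, h2⟩ := lt_min_iff.1 hlen
      rcases hw with hw | ⟨w, rfl, hw⟩
      · exact (ih hw h1).cons _
      · exact (ih (ih hw (by simpa using h2)) h1).cons _

lemma extBound_succ_self (t : ℕ) :
    extBound j (t + 1) (j (t + 1)) = extBound j t (j (t + 1)) + 1 := by
  simp [extBound]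

lemma lt_extBound_succ {t a : ℕ} {s : Fin k} (ha : a ≤ extBound j t (j (t + 1)))
    (hs : a < extBound j t s) : a < extBound j (t + 1) s := by
  rw [extBound]
  split_ifs
  · omega
  · exact lt_min hs (by omega)

lemma extBound_ne {p q : ℕ} (hpq : p < q) : extBound j p ≠ extBound j q := by
  obtain ⟨r, hr, hmin⟩ := Finset.exists_min_image (Finset.Ico p q)
    (fun t => extBound j t (j (t + 1))) ⟨p, by simpa using hpq⟩
  rw [Finset.mem_Ico] at hr
  set a := extBound j r (j (r + 1)) with ha
  have mono : ∀ t t', p ≤ t → t ≤ t' → t' ≤ q → ∀ s, a < extBound j t s → a < extBound j t' s := by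
    intro t t' hpt htt'
    induction t', htt' using Nat.le_induction with
    | base => exact fun _ _ h => h
    | succ t' h ih =>
      intro hq s hs
      exact lt_extBound_succ j (hmin t' (Finset.mem_Ico.2 ⟨by omega, by omega⟩))
        (ih (by omega) s hs)
  intro heq
  have h1 : a < extBound j q (j (r + 1)) :=
    mono (r + 1) q (by omega) (by omega) le_rfl _ (by rw [extBound_succ_self]; omega)
  rw [← heq] at h1
  exact lt_irrefl a (mono p r le_rfl hr.1 hr.2.le _ h1)

end Words

lemma prodSeq_eq_wordProd {n k : ℕ} (A : Fin k → Matrix (Fin n) (Fin n) ℝ≥0) (j : ℕ → Fin k)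
    (t : ℕ) : prodSeq A j t = wordProd A (revWord j t) := by
  induction t with
  | zero => rfl
  | succ t ih => rw [prodSeq, ih, revWord, wordProd_cons]

lemma prodSeq_eq_succ {n k : ℕ} {A : Fin k → Matrix (Fin n) (Fin n) ℝ≥0}
    (hdiag : ∀ s i, A s i i = 1)
    (hprod : ∀ L : List (Fin k), L.length ≤ n → maxCycleMean (wordProd A L) ≤ 1)
    (j : ℕ → Fin k) (t : ℕ) (ht : n ≤ extBound j t (j (t + 1)) + 1) :
    prodSeq A j t = prodSeq A j (t + 1) := by
  rw [prodSeq_eq_wordProd, prodSeq_eq_wordProd]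
  ext1 i l
  apply le_antisymm
  · exact wordProd_le_of_sublist hdiag (List.sublist_cons_self _ _) i l
  · obtain ⟨u, hu, hun, hle⟩ := exists_short_sublist hprod (revWord j (t + 1)) i l
    refine hle.trans (wordProd_le_of_sublist hdiag ?_ i l)
    rw [revWord, List.sublist_cons_iff] at hu
    rcases hu with hu | ⟨w, rfl, hw⟩
    · exact hu
    · rw [List.length_cons] at hun
      exact cons_sublist_revWord j hw (by omega)

/-- stabilization of arbitrary products of matrices with unit diagonal all
of whose subproducts of length at most `n` have cycle mean at most 1. -/
theorem stmt16 {n k : ℕ} (A : Fin k → Matrix (Fin n) (Fin n) ℝ≥0)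
    (hdiag : ∀ s i, A s i i = 1)
    (hprod : ∀ L : List (Fin k), L.length ≤ n →
      maxCycleMean ((L.map A).foldr mProd (mId n)) ≤ 1)
    (j : ℕ → Fin k) :
    ∃ t : ℕ, t ≤ n ^ k - 1 ∧ prodSeq A j t = prodSeq A j (t + 1) := by
  rcases Nat.eq_zero_or_pos n with rfl | hn
  · exact ⟨0, Nat.zero_le _, by ext1 i; exact i.elim0⟩
  by_contra! hne
  have hpos : 0 < n ^ k := Nat.pow_pos hn
  have hstep : ∀ t, t < n ^ k → extBound j t (j (t + 1)) + 1 < n := fun t ht => by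
    by_contra! h
    exact hne t (by omega) (prodSeq_eq_succ hdiag hprod j t h)
  have hbound : ∀ t, t ≤ n ^ k → ∀ s, extBound j t s < n := by
    intro t
    induction t with
    | zero => exact fun _ _ => hn
    | succ t ih =>
      intro ht s
      rw [extBound]
      split_ifs with hs
      · exact hs ▸ hstep t ht
      · exact (min_le_left _ _).trans_lt (ih (by omega) s)
  obtain ⟨p, q, hpq, he⟩ := Fintype.exists_ne_map_eq_of_card_lt
    (fun (t : Fin (n ^ k + 1)) (s : Fin k) =>
      (⟨extBound j t s, hbound t (by omega) s⟩ : Fin n)) (by simp)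
  have he' : extBound j p = extBound j q :=
    funext fun s => congrArg Fin.val (congrFun he s)
  rcases lt_or_gt_of_ne hpq with h | h
  · exact extBound_ne j h he'
  · exact extBound_ne j h he'.symm

end MaxAlg
end

section
/- Let A^(1) ∈ ℝ₊^{n×m₁},…,A^(k) ∈ ℝ₊^{n×m_k} have all rows nonzero, and suppose span(A^(1)) ∩ … ∩ span(A^(k)) contains a vector all of whose coordinates are positive. Let P_i denote the projector onto span(A^(i)). Then for every y^(0) ∈ ℝ₊ⁿ with all coordinates positive, the sequence y^(l) = (P_k ∘ ⋯ ∘ P_1)^l(y^(0)) is eventually constant, and its eventual value is a positive vector lying in span(A^(1)) ∩ … ∩ span(A^(k)); in particular the alternating method finds, in finitely many iterations, a positive solution of the system A^(1)⊗x¹ = … = A^(k)⊗x^k. -/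
open scoped NNReal Classical

namespace MaxAlg

open Filter Topology

/-- The largest `c` with `c • v ≤ y`, taken to be `1` when `v = 0`. -/
noncomputable def residual {n : ℕ} (v y : Fin n → ℝ≥0) : ℝ≥0 :=
  if h : (Finset.univ.filter fun i => v i ≠ 0).Nonempty then
    (Finset.univ.filter fun i => v i ≠ 0).inf' h fun i => y i / v i
  else 1

theorem exists_residual_eq {n : ℕ} (v y : Fin n → ℝ≥0) {i : Fin n} (hi : v i ≠ 0) :
    ∃ t, v t ≠ 0 ∧ residual v y = y t / v t := by
  have h : (Finset.univ.filter fun i => v i ≠ 0).Nonempty := ⟨i, by simpa using hi⟩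
  obtain ⟨t, ht, hte⟩ := Finset.exists_mem_eq_inf' h fun i => y i / v i
  exact ⟨t, by simpa using ht, by rw [residual, dif_pos h, hte]⟩

theorem mul_residual_le {n : ℕ} (v y : Fin n → ℝ≥0) (i : Fin n) : v i * residual v y ≤ y i := by
  by_cases hi : v i = 0
  · simp [hi]
  have hmem : i ∈ Finset.univ.filter fun i => v i ≠ 0 := by simpa using hi
  have hle : residual v y ≤ y i / v i := by
    rw [residual, dif_pos ⟨i, hmem⟩]
    exact Finset.inf'_le (fun i => y i / v i) hmem
  calc v i * residual v y ≤ v i * (y i / v i) := by gcongr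
    _ = y i := mul_div_cancel₀ _ hi

theorem le_residual {n : ℕ} {v y : Fin n → ℝ≥0} {c : ℝ≥0} {i : Fin n} (hi : v i ≠ 0)
    (h : ∀ t, v t * c ≤ y t) : c ≤ residual v y := by
  obtain ⟨t, ht, hte⟩ := exists_residual_eq v y hi
  rw [hte, le_div_iff₀ (pos_iff_ne_zero.2 ht), mul_comm]
  exact h t

theorem residual_pos {n : ℕ} (v : Fin n → ℝ≥0) {y : Fin n → ℝ≥0} (hy : ∀ i, 0 < y i) :
    0 < residual v y := by
  by_cases h : ∃ i, v i ≠ 0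
  · obtain ⟨i, hi⟩ := h
    obtain ⟨t, ht, hte⟩ := exists_residual_eq v y hi
    rw [hte]
    exact div_pos (hy t) (pos_iff_ne_zero.2 ht)
  · push Not at h
    simp [residual, h]

theorem isGreatest_mulVec_residual {n m : ℕ} (A : Matrix (Fin n) (Fin m) ℝ≥0)
    (y : Fin n → ℝ≥0) :
    IsGreatest {v ∈ matSpan A | v ≤ y} (mulVec A fun j => residual (fun i => A i j) y) := by
  refine ⟨⟨⟨_, rfl⟩, fun i => Finset.sup_le fun j _ => mul_residual_le (fun i => A i j) y i⟩, ?_⟩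
  rintro _ ⟨⟨x, rfl⟩, hx⟩ i
  refine Finset.sup_mono_fun fun j _ => ?_
  by_cases hij : A i j = 0
  · simp [hij]
  · gcongr
    exact le_residual (v := fun i => A i j) hij fun t =>
      (Finset.le_sup (f := fun j => A t j * x j) (Finset.mem_univ j)).trans (hx t)

theorem proj_eq_of_isGreatest {n : ℕ} {V : Set (Fin n → ℝ≥0)} {y p : Fin n → ℝ≥0}
    (hp : IsGreatest {v ∈ V | v ≤ y} p) : proj V y = p := by
  funext i
  refine IsGreatest.csSup_eq ⟨⟨p, hp.1, rfl⟩, ?_⟩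
  rintro _ ⟨v, hv, rfl⟩
  exact hp.2 hv i

theorem proj_matSpan {n m : ℕ} (A : Matrix (Fin n) (Fin m) ℝ≥0) (y : Fin n → ℝ≥0) :
    proj (matSpan A) y = mulVec A fun j => residual (fun i => A i j) y :=
  proj_eq_of_isGreatest (isGreatest_mulVec_residual A y)

theorem proj_matSpan_le {n m : ℕ} (A : Matrix (Fin n) (Fin m) ℝ≥0) (y : Fin n → ℝ≥0) :
    proj (matSpan A) y ≤ y :=
  proj_matSpan A y ▸ (isGreatest_mulVec_residual A y).1.2

theorem le_proj_matSpan {n m : ℕ} {A : Matrix (Fin n) (Fin m) ℝ≥0} {v y : Fin n → ℝ≥0}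
    (hv : v ∈ matSpan A) (hvy : v ≤ y) : v ≤ proj (matSpan A) y :=
  proj_matSpan A y ▸ (isGreatest_mulVec_residual A y).2 ⟨hv, hvy⟩

theorem smul_mem_matSpan {n m : ℕ} {A : Matrix (Fin n) (Fin m) ℝ≥0} {v : Fin n → ℝ≥0}
    (hv : v ∈ matSpan A) (c : ℝ≥0) : (fun i => v i * c) ∈ matSpan A := by
  obtain ⟨x, rfl⟩ := hv
  refine ⟨fun j => x j * c, funext fun i => ?_⟩
  simp only [mulVec, NNReal.finset_sup_mul, mul_assoc]

/-- Every coordinate of `F y` is a coordinate of `y` times a weight from a finite set not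
depending on `y`. -/
def HasFiniteWeights {n : ℕ} (F : (Fin n → ℝ≥0) → Fin n → ℝ≥0) : Prop :=
  ∃ W : Finset ℝ≥0, ∀ y i, ∃ w ∈ W, ∃ t, F y i = w * y t

theorem hasFiniteWeights_proj {n m : ℕ} {A : Matrix (Fin n) (Fin m) ℝ≥0}
    (hrow : ∀ i, ∃ j, A i j ≠ 0) : HasFiniteWeights (proj (matSpan A)) := by
  refine ⟨Finset.univ.image fun p : Fin n × Fin n × Fin m => A p.1 p.2.2 / A p.2.1 p.2.2,
    fun y i => ?_⟩
  have key : ∃ j, A i j ≠ 0 ∧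
      proj (matSpan A) y i = A i j * residual (fun i => A i j) y := by
    obtain ⟨j₀, hj₀⟩ := hrow i
    obtain ⟨j, -, hj⟩ := Finset.exists_mem_eq_sup Finset.univ ⟨j₀, Finset.mem_univ _⟩
      fun j => A i j * residual (fun i => A i j) y
    have hj' : proj (matSpan A) y i = A i j * residual (fun i => A i j) y := by
      rw [proj_matSpan]; exact hj
    by_cases hij : A i j = 0
    · refine ⟨j₀, hj₀, le_antisymm (by simp [hj', hij]) ?_⟩
      rw [proj_matSpan]
      exact Finset.le_sup (f := fun j => A i j * residual (fun i => A i j) y)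
        (Finset.mem_univ j₀)
    · exact ⟨j, hij, hj'⟩
  obtain ⟨j, hij, hj⟩ := key
  obtain ⟨t, -, hte⟩ := exists_residual_eq (fun i => A i j) y hij
  refine ⟨A i j / A t j, Finset.mem_image.2 ⟨(i, t, j), Finset.mem_univ _, rfl⟩, t, ?_⟩
  rw [hj, hte, mul_div_assoc', div_mul_eq_mul_div]

theorem HasFiniteWeights.comp {n : ℕ} {F G : (Fin n → ℝ≥0) → Fin n → ℝ≥0}
    (hF : HasFiniteWeights F) (hG : HasFiniteWeights G) :
    HasFiniteWeights fun y => F (G y) := by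
  obtain ⟨W, hW⟩ := hF
  obtain ⟨U, hU⟩ := hG
  refine ⟨(W ×ˢ U).image fun p => p.1 * p.2, fun y i => ?_⟩
  obtain ⟨w, hw, t, ht⟩ := hW (G y) i
  obtain ⟨u, hu, r, hr⟩ := hU y t
  refine ⟨w * u, Finset.mem_image.2 ⟨(w, u), Finset.mk_mem_product hw hu, rfl⟩, r, ?_⟩
  simp only [ht, hr, mul_assoc]

theorem hasFiniteWeights_foldl {n : ℕ} (l : List ((Fin n → ℝ≥0) → Fin n → ℝ≥0))
    (hl : ∀ f ∈ l, HasFiniteWeights f) :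
    HasFiniteWeights fun y => l.foldl (fun z f => f z) y := by
  induction l with
  | nil => exact ⟨{1}, fun y i => ⟨1, by simp, i, by simp⟩⟩
  | cons f l ih =>
    rw [List.forall_mem_cons] at hl
    exact (ih hl.2).comp hl.1

theorem foldl_le {α : Type*} [Preorder α] (l : List (α → α)) (hl : ∀ f ∈ l, ∀ z, f z ≤ z)
    (y : α) : l.foldl (fun z f => f z) y ≤ y := by
  induction l generalizing y with
  | nil => exact le_rfl
  | cons f l ih =>
    rw [List.forall_mem_cons] at hl
    exact (ih hl.2 _).trans (hl.1 y)

theorem le_foldl {α : Type*} [Preorder α] (l : List (α → α)) {v : α}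
    (hl : ∀ f ∈ l, ∀ z, v ≤ z → v ≤ f z) {y : α} (hy : v ≤ y) :
    v ≤ l.foldl (fun z f => f z) y := by
  induction l generalizing y with
  | nil => exact hy
  | cons f l ih =>
    rw [List.forall_mem_cons] at hl
    exact ih hl.2 (hl.1 y hy)

theorem eq_of_foldl_eq {α : Type*} [PartialOrder α] (l : List (α → α))
    (hl : ∀ f ∈ l, ∀ z, f z ≤ z) {y : α} (hy : l.foldl (fun z f => f z) y = y) :
    ∀ f ∈ l, f y = y := by
  induction l with
  | nil => simp
  | cons f l ih =>
    rw [List.forall_mem_cons] at hl ⊢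
    have hf : f y = y := by
      refine le_antisymm (hl.1 y) ?_
      conv_lhs => rw [← hy]
      exact foldl_le l hl.2 (f y)
    exact ⟨hf, ih hl.2 (by rwa [List.foldl_cons, hf] at hy)⟩

/-- Iterating a deflationary map with finitely many weights stabilizes as soon as the orbit
is bounded below by a positive vector: near its limit `z`, the map only permutes and repeats
the finitely many ratios `y i / z i`. -/
theorem HasFiniteWeights.eventually_const {n : ℕ} {F : (Fin n → ℝ≥0) → Fin n → ℝ≥0}
    (hF : HasFiniteWeights F) (hle : ∀ y, F y ≤ y) {y v : Fin n → ℝ≥0} (hv : ∀ i, 0 < v i)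
    (hlow : ∀ l, v ≤ F^[l] y) : ∃ L, ∀ l, L ≤ l → F^[l] y = F^[L] y := by
  obtain ⟨W, hW⟩ := hF
  have hanti : Antitone fun l => F^[l] y := antitone_nat_of_succ_le fun l => by
    rw [Function.iterate_succ_apply']; exact hle _
  have hex : ∀ i, ∃ z, Tendsto (fun l => F^[l] y i) atTop (𝓝 z) := fun i =>
    ⟨_, tendsto_atTop_ciInf (fun a b h => hanti h i) (OrderBot.bddBelow _)⟩
  choose z hz using hex
  have hzpos : ∀ i, z i ≠ 0 := fun i =>
    ((hv i).trans_le (ge_of_tendsto' (hz i) fun l => hlow l i)).ne'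
  have hstep : ∀ᶠ l in atTop, ∀ i, ∃ t, F^[l + 1] y i / z i = F^[l] y t / z t := by
    have hev : ∀ᶠ l in atTop, ∀ i t, ∀ w ∈ W, F^[l + 1] y i = w * F^[l] y t →
        z i = w * z t := by
      rw [eventually_all]; intro i
      rw [eventually_all]; intro t
      rw [eventually_all_finset]; intro w _
      by_cases h : z i = w * z t
      · exact Eventually.of_forall fun _ _ => h
      · have hprod : Tendsto (fun l => (F^[l + 1] y i, w * F^[l] y t)) atTop
            (𝓝 (z i, w * z t)) :=
          ((hz i).comp (tendsto_add_atTop_nat 1)).prodMk_nhds ((hz t).const_mul w)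
        filter_upwards [hprod.eventually (isClosed_diagonal.isOpen_compl.mem_nhds h)] with l hl hl'
        exact absurd hl' hl
    filter_upwards [hev] with l hl i
    obtain ⟨w, hw, t, ht⟩ := hW (F^[l] y) i
    rw [← Function.iterate_succ_apply' F l y] at ht
    have hzi := hl i t w hw ht
    have hw0 : w ≠ 0 := by rintro rfl; exact hzpos i (by simpa using hzi)
    exact ⟨t, by rw [ht, hzi, mul_div_mul_left _ _ hw0]⟩
  obtain ⟨N, hN⟩ := eventually_atTop.1 hstep
  have hratio : ∀ l, N ≤ l → ∀ i, ∃ t, F^[l] y i / z i = F^[N] y t / z t := by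
    intro l hl
    induction l, hl using Nat.le_induction with
    | base => exact fun i => ⟨i, rfl⟩
    | succ l hl ih =>
      intro i
      obtain ⟨t, ht⟩ := hN l hl i
      obtain ⟨r, hr⟩ := ih t
      exact ⟨r, ht.trans hr⟩
  have hlim : ∀ᶠ l in atTop, F^[l] y = z := by
    have hev : ∀ᶠ l in atTop, ∀ i t, F^[l] y i / z i = F^[N] y t / z t →
        F^[N] y t / z t = 1 := by
      rw [eventually_all]; intro i
      rw [eventually_all]; intro t
      by_cases h : F^[N] y t / z t = 1
      · exact Eventually.of_forall fun _ _ => h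
      · have hto : Tendsto (fun l => F^[l] y i / z i) atTop (𝓝 1) := by
          simpa [div_self (hzpos i)] using (hz i).div_const (z i)
        filter_upwards [hto.eventually_ne (Ne.symm h)] with l hl hl'
        exact absurd hl' hl
    filter_upwards [hev, eventually_ge_atTop N] with l hl hNl
    funext i
    obtain ⟨t, ht⟩ := hratio l hNl i
    exact (div_eq_one_iff_eq (hzpos i)).1 (ht.trans (hl i t ht))
  obtain ⟨L, hL⟩ := eventually_atTop.1 hlim
  exact ⟨L, fun l hl => (hL l hl).trans (hL L le_rfl).symm⟩

/-- if the column spans of `A^(1),…,A^(k)` share a positive vector, the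
alternating method started from any positive vector is eventually constant, with
positive limit in the intersection, yielding a positive solution of the multi-sided
system. -/
theorem stmt17 {n k : ℕ} (mdim : Fin k → ℕ)
    (A : (s : Fin k) → Matrix (Fin n) (Fin (mdim s)) ℝ≥0)
    (hrow : ∀ s i, ∃ j, A s i j ≠ 0)
    (hpos : ∃ x : Fin n → ℝ≥0, (∀ s, x ∈ matSpan (A s)) ∧ ∀ i, 0 < x i)
    (y0 : Fin n → ℝ≥0) (hy0 : ∀ i, 0 < y0 i) :
    ∃ L : ℕ,
      (∀ l : ℕ, L ≤ l → (cycProj A)^[l] y0 = (cycProj A)^[L] y0) ∧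
      (∀ i, 0 < (cycProj A)^[L] y0 i) ∧
      (∀ s, (cycProj A)^[L] y0 ∈ matSpan (A s)) ∧
      ∃ x : (s : Fin k) → Fin (mdim s) → ℝ≥0,
        (∀ s, mulVec (A s) (x s) = (cycProj A)^[L] y0) ∧ ∀ s i, 0 < x s i := by
  obtain ⟨x, hx, hxpos⟩ := hpos
  set fs := List.ofFn fun s => proj (matSpan (A s)) with hfs
  have hdefl : ∀ f ∈ fs, ∀ z, f z ≤ z := by
    rw [hfs, List.forall_mem_ofFn_iff]
    exact fun s z => proj_matSpan_le (A s) z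
  set v : Fin n → ℝ≥0 := fun i => x i * residual x y0
  have hvpos : ∀ i, 0 < v i := fun i => mul_pos (hxpos i) (residual_pos x hy0)
  have hvle : ∀ f ∈ fs, ∀ z, v ≤ z → v ≤ f z := by
    rw [hfs, List.forall_mem_ofFn_iff]
    exact fun s z hz => le_proj_matSpan (smul_mem_matSpan (hx s) _) hz
  have hlow : ∀ l, v ≤ (cycProj A)^[l] y0 := by
    intro l
    induction l with
    | zero => exact mul_residual_le x y0
    | succ l ih =>
      rw [Function.iterate_succ_apply']
      exact le_foldl fs hvle ih
  have hweights : HasFiniteWeights (cycProj A) := by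
    refine hasFiniteWeights_foldl fs ?_
    rw [hfs, List.forall_mem_ofFn_iff]
    exact fun s => hasFiniteWeights_proj (hrow s)
  obtain ⟨L, hL⟩ := hweights.eventually_const (foldl_le fs hdefl) hvpos hlow
  have hLpos : ∀ i, 0 < (cycProj A)^[L] y0 i := fun i => (hvpos i).trans_le (hlow L i)
  have hfix : ∀ s, proj (matSpan (A s)) ((cycProj A)^[L] y0) = (cycProj A)^[L] y0 := by
    rw [← List.forall_mem_ofFn_iff (f := fun s => proj (matSpan (A s)))
      (P := fun f => f ((cycProj A)^[L] y0) = (cycProj A)^[L] y0)]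
    refine eq_of_foldl_eq fs hdefl ?_
    exact (Function.iterate_succ_apply' (cycProj A) L y0).symm.trans (hL (L + 1) L.le_succ)
  have hsol : ∀ s, mulVec (A s) (fun j => residual (fun i => A s i j) ((cycProj A)^[L] y0)) =
      (cycProj A)^[L] y0 := fun s => (proj_matSpan (A s) _).symm.trans (hfix s)
  exact ⟨L, hL, hLpos, fun s => ⟨_, (hsol s).symm⟩, _, hsol, fun s j => residual_pos _ hLpos⟩

end MaxAlg
end

section
/- Let V¹,…,V^k ⊆ ℝ₊ⁿ be closed max cones, each containing a nonzero vector. Then ρ_Σ(V¹,…,V^k) = 0 if and only if V¹ ∩ … ∩ V^k contains a nonzero vector. -/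
open scoped NNReal Classical

namespace MaxAlg

/-- The set of coordinate ratios whose supremum defines `rhoH` is bounded above. -/
lemma bddAbove_ratios {n : ℕ} (y1 y2 : Fin n → ℝ≥0) :
    BddAbove { t : ℝ≥0 | ∃ i ∈ supp y1, ∃ j ∈ supp y1,
        t = y1 i / y2 i * (y2 j / y1 j) } := by
  refine ((Set.finite_range fun p : Fin n × Fin n =>
    y1 p.1 / y2 p.1 * (y2 p.2 / y1 p.2)).subset ?_).bddAbove
  rintro t ⟨i, -, j, -, rfl⟩
  exact ⟨(i, j), rfl⟩

lemma rhoH_nonneg {n : ℕ} {y1 : Fin n → ℝ≥0} (h : y1 ≠ 0) (y2 : Fin n → ℝ≥0) :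
    0 ≤ rhoH y1 y2 := by
  unfold rhoH
  split_ifs with hs
  · obtain ⟨i, hi⟩ := Function.ne_iff.1 h
    have hi1 : i ∈ supp y1 := hi
    have hi2 : i ∈ supp y2 := hs ▸ hi1
    have hi1' : y1 i ≠ 0 := hi1
    have hi2' : y2 i ≠ 0 := hi2
    have h1 := le_csSup (bddAbove_ratios y1 y2) ⟨i, hi1, i, hi1, rfl⟩
    have h2 : y1 i / y2 i * (y2 i / y1 i) = 1 := by field_simp
    rw [h2] at h1
    exact EReal.coe_nonneg.2 (Real.log_nonneg (NNReal.coe_le_coe.2 h1))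
  · exact le_top

lemma rhoH_self {n : ℕ} {y : Fin n → ℝ≥0} (h : y ≠ 0) : rhoH y y = 0 := by
  obtain ⟨i, hi⟩ := Function.ne_iff.1 h
  have : { t : ℝ≥0 | ∃ i ∈ supp y, ∃ j ∈ supp y, t = y i / y i * (y j / y j) } = {1} := by
    ext t
    constructor
    · rintro ⟨i, hi, j, hj, rfl⟩
      have hi' : y i ≠ 0 := hi
      have hj' : y j ≠ 0 := hj
      simp [hi', hj']
    · rintro rfl
      have hi' : y i ≠ 0 := hi
      exact ⟨i, hi, i, hi, by simp [hi']⟩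
  rw [rhoH, if_pos rfl, this, csSup_singleton]
  simp

/-- A bound on the Hilbert distance yields a division-free comparison of the coordinates. -/
lemma mul_le_of_rhoH_le {n : ℕ} {y1 y2 : Fin n → ℝ≥0} {a : ℝ≥0} (ha : 0 < a)
    (h : rhoH y1 y2 ≤ (Real.log a : ℝ)) (i j : Fin n) :
    y1 i * y2 j ≤ a * (y2 i * y1 j) := by
  unfold rhoH at h
  split_ifs at h with hs
  · by_cases hi : y1 i = 0
    · simp [hi]
    by_cases hj : y2 j = 0
    · simp [hj]
    have hi2 : y2 i ≠ 0 := (hs ▸ (show i ∈ supp y1 from hi) : i ∈ supp y2)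
    have hj1' : j ∈ supp y1 := by rw [hs]; exact hj
    have hj1 : y1 j ≠ 0 := hj1'
    have h1 := le_csSup (bddAbove_ratios y1 y2) ⟨i, hi, j, hj1', rfl⟩
    have hpos : 0 < y1 i / y2 i * (y2 j / y1 j) := by positivity
    have h2 := (Real.log_le_log_iff (by exact_mod_cast hpos.trans_le h1)
      (by exact_mod_cast ha)).1 (EReal.coe_le_coe_iff.1 h)
    have h3 := h1.trans (NNReal.coe_le_coe.1 h2)
    calc y1 i * y2 j = y1 i / y2 i * (y2 j / y1 j) * (y2 i * y1 j) := by field_simp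
      _ ≤ a * (y2 i * y1 j) := by gcongr
  · exact absurd h (by simp)

/-- After scaling both vectors to have maximal coordinate `1`, a small Hilbert distance forces
coordinatewise comparability. -/
lemma normalize_le_of_rhoH_le {n : ℕ} {y1 y2 : Fin n → ℝ≥0} (h1 : y1 ≠ 0) (h2 : y2 ≠ 0)
    {a : ℝ≥0} (ha : 0 < a) (h : rhoH y1 y2 ≤ (Real.log a : ℝ)) (i : Fin n) :
    (Finset.univ.sup y1)⁻¹ * y1 i ≤ a * ((Finset.univ.sup y2)⁻¹ * y2 i) := by
  have hpos : ∀ y : Fin n → ℝ≥0, y ≠ 0 → 0 < Finset.univ.sup y := fun y hy => by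
    obtain ⟨l, hl⟩ := Function.ne_iff.1 hy
    exact (pos_iff_ne_zero.2 hl).trans_le (Finset.le_sup (Finset.mem_univ l))
  obtain ⟨j, -, hj⟩ := Finset.exists_mem_eq_sup Finset.univ ⟨i, Finset.mem_univ i⟩ y2
  have p1 := hpos y1 h1
  have p2 := hpos y2 h2
  have key : y1 i * Finset.univ.sup y2 ≤ a * (y2 i * Finset.univ.sup y1) := by
    calc y1 i * Finset.univ.sup y2 = y1 i * y2 j := by rw [hj]
      _ ≤ a * (y2 i * y1 j) := mul_le_of_rhoH_le ha h i j
      _ ≤ _ := by gcongr; exact Finset.le_sup (Finset.mem_univ j)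
  generalize Finset.univ.sup y1 = c1 at *
  generalize Finset.univ.sup y2 = c2 at *
  calc c1⁻¹ * y1 i = (y1 i * c2) * (c1⁻¹ * c2⁻¹) := by field_simp
    _ ≤ (a * (y2 i * c1)) * (c1⁻¹ * c2⁻¹) := by gcongr
    _ = _ := by field_simp

lemma sup_normalize {n : ℕ} {y : Fin n → ℝ≥0} (h : y ≠ 0) :
    (Finset.univ.sup fun i => (Finset.univ.sup y)⁻¹ * y i) = 1 := by
  obtain ⟨l, hl⟩ := Function.ne_iff.1 h
  have hpos := (pos_iff_ne_zero.2 hl).trans_le (Finset.le_sup (f := y) (Finset.mem_univ l))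
  rw [← NNReal.mul_finset_sup, inv_mul_cancel₀ hpos.ne']

/-- A family indexed by `Fin k` that increases along the cyclic successor is constant. -/
lemma le_of_cyclic_le {α : Type*} [Preorder α] {k : ℕ} (hk : 0 < k) (Z : Fin k → α)
    (h : ∀ s : Fin k, Z s ≤ Z ⟨((s : ℕ) + 1) % k, Nat.mod_lt _ hk⟩) (s t : Fin k) :
    Z s ≤ Z t := by
  have step : ∀ m : ℕ, Z s ≤ Z ⟨((s : ℕ) + m) % k, Nat.mod_lt _ hk⟩ := by
    intro m
    induction m with
    | zero => simp [Nat.mod_eq_of_lt s.2]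
    | succ m ih =>
      refine ih.trans ((h _).trans (le_of_eq ?_))
      congr 2
      simp [← add_assoc]
  refine (step (k - s + t)).trans (le_of_eq ?_)
  congr 1
  ext
  have hs := s.2
  have : (s : ℕ) + (k - s + t) = t + k := by omega
  simp [this, Nat.mod_eq_of_lt t.2]

lemma sum_rhoH_nonneg {n k : ℕ} {y : Fin k → Fin n → ℝ≥0} (hy : ∀ s, y s ≠ 0)
    (f : Fin k → Fin k) : 0 ≤ ∑ s, rhoH (y s) (y (f s)) :=
  Finset.sum_nonneg fun s _ => rhoH_nonneg (hy s) _

/-- the total projective distance between closed max cones vanishes iff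
their intersection is nontrivial. -/
theorem stmt18 {n k : ℕ} (hk : 0 < k) (V : Fin k → Set (Fin n → ℝ≥0))
    (hV : ∀ s, IsMaxCone (V s)) (hVc : ∀ s, IsClosed (V s))
    (hne : ∀ s, ∃ y, y ∈ V s ∧ y ≠ 0) :
    sInf { d : EReal |
        ∃ y : Fin k → Fin n → ℝ≥0, (∀ s, y s ∈ V s ∧ y s ≠ 0) ∧
          d = ∑ s : Fin k, rhoH (y s) (y ⟨((s : ℕ) + 1) % k, Nat.mod_lt _ hk⟩) } = 0 ↔
      ∃ x : Fin n → ℝ≥0, (∀ s, x ∈ V s) ∧ x ≠ 0 := by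
  constructor
  · intro h
    let a : ℕ → ℝ≥0 := fun l => 1 + 1 / ((l : ℝ≥0) + 1)
    have ha : ∀ l, 1 < a l := fun l => lt_add_of_pos_right _ (by positivity)
    have hlim : Filter.Tendsto a Filter.atTop (nhds 1) := by
      have : Filter.Tendsto (fun l : ℕ => 1 / ((l : ℝ≥0) + 1)) Filter.atTop (nhds 0) :=
        tendsto_one_div_add_atTop_nhds_zero_nat
      simpa [a] using this.const_add 1
    have hex : ∀ l : ℕ, ∃ Z : Fin k → Fin n → ℝ≥0, (∀ s, Z s ∈ V s) ∧
        (∀ s, Finset.univ.sup (Z s) = 1) ∧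
        ∀ s i, Z s i ≤ a l * Z ⟨((s : ℕ) + 1) % k, Nat.mod_lt _ hk⟩ i := by
      intro l
      have hpos : (0 : EReal) < (Real.log (a l) : ℝ) := by
        exact_mod_cast Real.log_pos (by exact_mod_cast ha l)
      rw [← h] at hpos
      obtain ⟨d, ⟨y, hy, rfl⟩, hd⟩ := sInf_lt_iff.1 hpos
      refine ⟨fun s => (Finset.univ.sup (y s))⁻¹ • y s, fun s => (hV s).2 _ _ (hy s).1,
        fun s => sup_normalize (hy s).2, fun s i => ?_⟩
      refine normalize_le_of_rhoH_le (hy s).2 (hy _).2 (zero_lt_one.trans (ha l))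
        (le_trans ?_ hd.le) i
      exact Finset.single_le_sum
        (f := fun s : Fin k => rhoH (y s) (y ⟨((s : ℕ) + 1) % k, Nat.mod_lt _ hk⟩))
        (fun t _ => rhoH_nonneg (hy t).2 _) (Finset.mem_univ s)
    choose Z hZV hZ1 hZ using hex
    have hmem : ∀ l, Z l ∈ Set.Icc (0 : Fin k → Fin n → ℝ≥0) 1 := fun l =>
      ⟨fun _ _ => zero_le, fun s i => (Finset.le_sup (Finset.mem_univ i)).trans (hZ1 l s).le⟩
    obtain ⟨W, -, φ, hφ, hW⟩ := isCompact_Icc.tendsto_subseq hmem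
    have hWs : ∀ s, Filter.Tendsto (fun l => Z (φ l) s) Filter.atTop (nhds (W s)) := tendsto_pi_nhds.1 hW
    have hWsi : ∀ s i, Filter.Tendsto (fun l => Z (φ l) s i) Filter.atTop (nhds (W s i)) := fun s =>
      tendsto_pi_nhds.1 (hWs s)
    have hWV : ∀ s, W s ∈ V s := fun s =>
      (hVc s).mem_of_tendsto (hWs s) (Filter.Eventually.of_forall fun l => hZV _ s)
    have hWle : ∀ s : Fin k, W s ≤ W ⟨((s : ℕ) + 1) % k, Nat.mod_lt _ hk⟩ := fun s i => by
      have hr := (hlim.comp hφ.tendsto_atTop).mul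
        (hWsi ⟨((s : ℕ) + 1) % k, Nat.mod_lt _ hk⟩ i)
      rw [one_mul] at hr
      exact le_of_tendsto_of_tendsto' (hWsi s i) hr fun l => hZ _ s i
    have hall := le_of_cyclic_le hk W hWle
    refine ⟨W ⟨0, hk⟩, fun s => ?_, fun h0 => ?_⟩
    · rw [le_antisymm (hall ⟨0, hk⟩ s) (hall s ⟨0, hk⟩)]
      exact hWV s
    · have hcont : Continuous fun x : Fin n → ℝ≥0 => Finset.univ.sup x :=
        Continuous.finset_sup_apply fun i _ => continuous_apply i
      have h1 := (hcont.tendsto _).comp (hWs ⟨0, hk⟩)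
      have h2 : Finset.univ.sup (W ⟨0, hk⟩) = 1 :=
        tendsto_nhds_unique h1 (by simp [Function.comp_def, hZ1])
      rw [h0] at h2
      have h3 : Finset.univ.sup (0 : Fin n → ℝ≥0) ≤ 0 := Finset.sup_le fun _ _ => le_rfl
      rw [h2] at h3
      exact absurd h3 (by simp)
  · rintro ⟨x, hxV, hx⟩
    refine le_antisymm (sInf_le ⟨fun _ => x, fun s => ⟨hxV s, hx⟩, ?_⟩) (le_sInf ?_)
    · simp [rhoH_self hx]
    · rintro d ⟨y, hy, rfl⟩
      exact sum_rhoH_nonneg (fun s => (hy s).2) _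

end MaxAlg
end
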